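/- Let σ be a C² symmetric 2-tensor on {x ∈ ℝ³ : |x| ≥ 1} with a constant c > 0 such that |σ(x)| ≤ c|x|⁻², |∂σ(x)| ≤ c|x|⁻³, and |∂²σ(x)| ≤ c|x|⁻⁴ for all |x| ≥ 1. Then for every λ > 1 and every a ∈ ℝ³: ∫_{{|x| ≥ λ}} |x|⁻³ [ ∑_{i,j,k=1}^{3} (xⱼ aₖ + aⱼ xₖ) ∂ᵢ∂ⱼσᵢₖ − ∑_{j,k=1}^{3} xⱼ aₖ (Δσⱼₖ) − (D²(tr σ))(x, a) + (D_a tr σ) − 3|x|⁻² (D_a σ)(x, x) ] dx = λ⁻² ∫_{S_λ(0)} [ D_a tr σ − (D_a σ)(ν̄, ν̄) ] dμ̄, where both integrals converge absolutely. -/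

import Mathlib

open MeasureTheory Metric

noncomputable abbrev E3 := EuclideanSpace ℝ (Fin 3)

/-- The Euclidean surface integral of `f` over the sphere of radius `lam` centered at `c`. -/
noncomputable def sphereIntegral (lam : ℝ) (c : E3) (f : E3 → ℝ) : ℝ :=
  lam ^ 2 * ∫ y : sphere (0 : E3) 1, f (c + lam • (y : E3)) ∂(volume : Measure E3).toSphere

/-- The partial derivative `∂ₖ σᵢⱼ` of a matrix-valued field at `x`. -/
noncomputable def pd (σ : E3 → Matrix (Fin 3) (Fin 3) ℝ) (k i j : Fin 3) (x : E3) : ℝ :=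
  fderiv ℝ (fun y => σ y i j) x (EuclideanSpace.single k 1)

/-- The second partial derivative `∂ₖ∂ₗ σᵢⱼ` of a matrix-valued field at `x`. -/
noncomputable def pd2 (σ : E3 → Matrix (Fin 3) (Fin 3) ℝ) (k l i j : Fin 3) (x : E3) : ℝ :=
  fderiv ℝ (fun y => pd σ l i j y) x (EuclideanSpace.single k 1)


open Set Filter Topology in
lemma polar_aux (f : E3 → ℝ) (hf : Integrable f) :
    Integrable (fun y : sphere (0 : E3) 1 => ∫ r in Ioi (0:ℝ), r ^ 2 * f (r • (y : E3)))
      (volume : Measure E3).toSphere ∧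
    ∫ x, f x = ∫ y : sphere (0 : E3) 1, (∫ r in Ioi (0:ℝ), r ^ 2 * f (r • (y : E3)))
      ∂(volume : Measure E3).toSphere := by
  have hmp := (volume : Measure E3).measurePreserving_homeomorphUnitSphereProd
  have hdim : Module.finrank ℝ E3 - 1 = 2 := by simp
  rw [hdim] at hmp
  set G : sphere (0 : E3) 1 × Ioi (0:ℝ) → ℝ := fun p => f (p.2.1 • (p.1 : E3)) with hG
  have hcomp : (fun x : ({0}ᶜ : Set E3) => G (homeomorphUnitSphereProd E3 x)) = fun x : ({0}ᶜ : Set E3) => f (x : E3) := by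
    ext x
    have hx : ‖(x : E3)‖ ≠ 0 := norm_ne_zero_iff.2 x.2
    simp [hG, smul_smul, hx]
  have hint : Integrable G ((volume : Measure E3).toSphere.prod (Measure.volumeIoiPow 2)) := by
    rw [← hmp.integrable_comp_emb (Homeomorph.measurableEmbedding _)]
    change Integrable (fun x : ({0}ᶜ : Set E3) => G (homeomorphUnitSphereProd E3 x)) _
    rw [hcomp]
    have := (integrableOn_iff_comap_subtypeVal (μ := (volume : Measure E3)) (f := f)
      (measurableSet_singleton (0 : E3)).compl).1 hf.integrableOn
    exact this
  have hin : ∀ y : sphere (0 : E3) 1, ∫ r : Ioi (0:ℝ), G (y, r) ∂(Measure.volumeIoiPow 2)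
      = ∫ r in Ioi (0:ℝ), r ^ 2 * f (r • (y : E3)) := by
    intro y
    simp only [Measure.volumeIoiPow, ENNReal.ofReal]
    rw [integral_withDensity_eq_integral_smul,
        integral_subtype_comap measurableSet_Ioi
          fun a : ℝ ↦ Real.toNNReal (a ^ 2) • f (a • (y : E3)),
        setIntegral_congr_fun measurableSet_Ioi fun x hx ↦ ?_]
    · simp only [NNReal.smul_def]
      rw [Real.coe_toNNReal _ (pow_nonneg (le_of_lt hx) _), smul_eq_mul]
    · exact (measurable_subtype_coe.pow_const _).real_toNNReal
  constructor
  · have := hint.integral_prod_left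
    simpa only [hin] using this
  · calc ∫ x, f x = ∫ x : ({(0)}ᶜ : Set E3), f x ∂((volume : Measure E3).comap (↑)) := by
          rw [integral_subtype_comap (measurableSet_singleton _).compl fun x ↦ f x,
            restrict_compl_singleton]
      _ = ∫ p, G p ∂((volume : Measure E3).toSphere.prod (Measure.volumeIoiPow 2)) := by
          rw [← hmp.integral_comp (Homeomorph.measurableEmbedding _), hcomp]
      _ = _ := by
          rw [integral_prod _ hint]
          simp only [hin]

lemma sT_contDiff : ContDiff ℝ 1 Real.smoothTransition :=
  Real.smoothTransition.contDiff (n := 1)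

lemma sT_hasDeriv (x : ℝ) : HasDerivAt Real.smoothTransition (deriv Real.smoothTransition x) x :=
  ((sT_contDiff.differentiable (by norm_num)) x).hasDerivAt

lemma sT_deriv_cont : Continuous (deriv Real.smoothTransition) :=
  sT_contDiff.continuous_deriv (by norm_num)

lemma sT_deriv_nonneg (x : ℝ) : 0 ≤ deriv Real.smoothTransition x :=
  Real.smoothTransition.monotone.deriv_nonneg

lemma sT_deriv_neg {x : ℝ} (hx : x ≤ 0) : deriv Real.smoothTransition x = 0 := by
  have h : IsLocalMin Real.smoothTransition x :=
    Filter.Eventually.of_forall fun y => by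
      rw [Real.smoothTransition.zero_of_nonpos hx]; exact Real.smoothTransition.nonneg y
  exact h.deriv_eq_zero

lemma sT_deriv_one {x : ℝ} (hx : 1 ≤ x) : deriv Real.smoothTransition x = 0 := by
  have h : IsLocalMax Real.smoothTransition x :=
    Filter.Eventually.of_forall fun y => by
      rw [Real.smoothTransition.one_of_one_le hx]; exact Real.smoothTransition.le_one y
  exact h.deriv_eq_zero

/-- one-dimensional peak kernel -/
noncomputable def pk (lam : ℝ) (n : ℕ) (r : ℝ) : ℝ :=
  deriv Real.smoothTransition (1 + n * (r ^ 2 - lam ^ 2)) * (n * (2 * r))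

lemma pk_cont (lam : ℝ) (n : ℕ) : Continuous (pk lam n) := by
  have := sT_deriv_cont
  unfold pk
  fun_prop

lemma pk_nonneg (lam : ℝ) (n : ℕ) {r : ℝ} (hr : 0 ≤ r) : 0 ≤ pk lam n r :=
  mul_nonneg (sT_deriv_nonneg _) (by positivity)

lemma pk_integral {lam b : ℝ} {n : ℕ} (hn : n * (b ^ 2 - lam ^ 2) ≤ -1) :
    ∫ r in b..lam, pk lam n r = 1 := by
  have h : ∀ r ∈ Set.uIcc b lam, HasDerivAt
      (fun r : ℝ => Real.smoothTransition (1 + n * (r ^ 2 - lam ^ 2))) (pk lam n r) r := by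
    intro r _
    have h1 : HasDerivAt (fun r : ℝ => 1 + n * (r ^ 2 - lam ^ 2)) (n * (2 * r)) r := by
      have := (((hasDerivAt_pow 2 r).sub_const (lam ^ 2)).const_mul (n : ℝ)).const_add 1
      simpa using this
    exact (sT_hasDeriv _).comp r h1
  rw [intervalIntegral.integral_eq_sub_of_hasDerivAt h ((pk_cont lam n).intervalIntegrable _ _)]
  rw [Real.smoothTransition.one_of_one_le (by simp),
    Real.smoothTransition.zero_of_nonpos (by linarith)]
  norm_num

lemma pk_zero_lt {lam r : ℝ} {n : ℕ} (hr : n * (r ^ 2 - lam ^ 2) ≤ -1) : pk lam n r = 0 := by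
  unfold pk
  rw [sT_deriv_neg (by linarith), zero_mul]

lemma pk_zero_gt {lam r : ℝ} {n : ℕ} (h0 : 0 ≤ lam) (hr : lam ≤ r) : pk lam n r = 0 := by
  unfold pk
  rw [sT_deriv_one, zero_mul]
  have : 0 ≤ (n:ℝ) * (r ^ 2 - lam ^ 2) := mul_nonneg (by positivity) (by nlinarith)
  linarith

lemma ev_n {lam b : ℝ} (hb : 0 ≤ b) (hbl : b < lam) :
    ∀ᶠ n : ℕ in Filter.atTop, (n:ℝ) * (b ^ 2 - lam ^ 2) ≤ -1 := by
  have hd : 0 < lam ^ 2 - b ^ 2 := by nlinarith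
  filter_upwards [tendsto_natCast_atTop_atTop.eventually_ge_atTop (lam ^ 2 - b ^ 2)⁻¹] with n hn
  have : 1 ≤ (n:ℝ) * (lam ^ 2 - b ^ 2) := by
    calc 1 = (lam ^ 2 - b ^ 2)⁻¹ * (lam ^ 2 - b ^ 2) := by field_simp
      _ ≤ _ := by gcongr
  linarith

open Set in
lemma pk_Ioi {lam b : ℝ} {n : ℕ} (hb : 0 < b) (hbl : b < lam)
    (hn : (n:ℝ) * (b ^ 2 - lam ^ 2) ≤ -1) (h : ℝ → ℝ) :
    ∫ r in Ioi (0:ℝ), pk lam n r * h r = ∫ r in b..lam, pk lam n r * h r := by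
  rw [intervalIntegral.integral_of_le hbl.le]
  apply setIntegral_eq_of_subset_of_forall_sdiff_eq_zero measurableSet_Ioi
  · intro r hr
    exact hb.trans hr.1
  · rintro r ⟨hr0, hr⟩
    have hr0 : 0 < r := hr0
    rcases le_or_gt r b with h1 | h1
    · rw [pk_zero_lt, zero_mul]
      have : (n:ℝ) * (r ^ 2 - lam ^ 2) ≤ n * (b ^ 2 - lam ^ 2) := by gcongr
      linarith
    · rw [pk_zero_gt (hb.trans hbl).le, zero_mul]
      by_contra hc
      exact hr ⟨h1, by linarith⟩

lemma pk_bound {lam b M : ℝ} {n : ℕ} (hb : 0 < b) (hbl : b < lam)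
    (hn : (n:ℝ) * (b ^ 2 - lam ^ 2) ≤ -1) (h : ℝ → ℝ)
    (hM : ∀ r ∈ Set.Ioc b lam, pk lam n r ≠ 0 → |h r| ≤ M) :
    |∫ r in b..lam, pk lam n r * h r| ≤ M := by
  have := intervalIntegral.norm_integral_le_of_norm_le (f := fun r => pk lam n r * h r)
    (g := fun r => pk lam n r * M) (μ := volume) hbl.le
    (Filter.Eventually.of_forall fun r hr => ?_)
    (((pk_cont lam n).mul continuous_const).intervalIntegrable _ _)
  · rw [intervalIntegral.integral_mul_const, pk_integral hn, one_mul] at this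
    exact this
  · have hp := pk_nonneg lam n (r := r) (hb.trans hr.1).le
    rw [norm_mul, Real.norm_of_nonneg hp, Real.norm_eq_abs]
    by_cases h0 : pk lam n r = 0
    · simp [h0]
    · gcongr
      exact hM r hr h0

open Set Filter Topology in
lemma pk_tendsto {lam b : ℝ} (hb : 0 < b) (hbl : b < lam) (h : ℝ → ℝ)
    (hh : ContinuousOn h (Icc b lam)) :
    Tendsto (fun n => ∫ r in Ioi (0:ℝ), pk lam n r * h r) atTop (𝓝 (h lam)) := by
  rw [Metric.tendsto_atTop']
  intro ε hε
  have hc := hh lam ⟨hbl.le, le_rfl⟩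
  rw [Metric.continuousWithinAt_iff] at hc
  obtain ⟨δ, hδ, hd⟩ := hc (ε / 2) (by positivity)
  set b' := max b (lam - δ / 2) with hb'
  have hb'b : b ≤ b' := le_max_left _ _
  have hb'l : b' < lam := max_lt hbl (by linarith)
  have h0b' : 0 < b' := hb.trans_le hb'b
  obtain ⟨N, hN⟩ := eventually_atTop.1 (ev_n h0b'.le hb'l)
  refine ⟨N, fun n hn => ?_⟩
  have hn := hN n hn.le
  rw [pk_Ioi h0b' hb'l hn]
  have e1 : (∫ r in b'..lam, pk lam n r * h r) - h lam
      = ∫ r in b'..lam, pk lam n r * (h r - h lam) := by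
    simp only [mul_sub]
    rw [intervalIntegral.integral_sub, intervalIntegral.integral_mul_const, pk_integral hn, one_mul]
    · apply ContinuousOn.intervalIntegrable
      rw [uIcc_of_le hb'l.le]
      exact (pk_cont lam n).continuousOn.mul (hh.mono (Icc_subset_Icc hb'b le_rfl))
    · exact ((pk_cont lam n).mul continuous_const).intervalIntegrable _ _
  rw [Real.dist_eq, e1]
  refine (pk_bound h0b' hb'l hn _ (M := ε / 2) ?_).trans_lt (by linarith)
  intro r hr _
  have := hd (x := r) ⟨hb'b.trans hr.1.le, hr.2⟩ (by
    rw [Real.dist_eq, abs_lt]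
    have := (le_max_right b (lam - δ/2)).trans_lt hr.1
    constructor <;> linarith [hr.2])
  rw [Real.dist_eq] at this
  exact this.le

open Set Filter Topology in
/-- Divergence theorem on the exterior of a ball, one component. -/
lemma ext_div (f : E3 → ℝ) (v : E3)
    (hf : ContDiffOn ℝ 1 f {x : E3 | 1 < ‖x‖})
    (hi : IntegrableOn f {x : E3 | 1 < ‖x‖})
    (hi' : IntegrableOn (fun x => fderiv ℝ f x v) {x : E3 | 1 < ‖x‖})
    (lam : ℝ) (hlam : 1 < lam) :
    ∫ x in {x : E3 | lam ≤ ‖x‖}, fderiv ℝ f x v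
      = - ∫ y : sphere (0 : E3) 1, lam ^ 2 * (inner ℝ (y : E3) v * f (lam • (y : E3)))
          ∂(volume : Measure E3).toSphere := by
  set b : ℝ := (1 + lam) / 2 with hb
  have hb1 : 1 < b := by rw [hb]; linarith
  have hb0 : 0 < b := by linarith
  have hbl : b < lam := by rw [hb]; linarith
  have hopen : IsOpen {x : E3 | 1 < ‖x‖} := isOpen_lt continuous_const continuous_norm
  have hmeas := hopen.measurableSet
  have hmeasl : MeasurableSet {x : E3 | lam ≤ ‖x‖} :=
    (isClosed_le continuous_const continuous_norm).measurableSet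
  have hsT := Real.smoothTransition.continuous
  have hsT' := sT_deriv_cont
  set ψ : ℕ → E3 → ℝ := fun n x => Real.smoothTransition (1 + n * (‖x‖ ^ 2 - lam ^ 2)) with hψ
  have hψc : ∀ n, Continuous (ψ n) := by intro n; rw [hψ]; fun_prop
  have hψb : ∀ n x, ‖ψ n x‖ ≤ 1 := by
    intro n x
    rw [Real.norm_of_nonneg (Real.smoothTransition.nonneg _)]
    exact Real.smoothTransition.le_one _
  set ψ' : ℕ → E3 → ℝ := fun n x =>
    deriv Real.smoothTransition (1 + n * (‖x‖ ^ 2 - lam ^ 2)) * (n * (2 * inner ℝ x v)) with hψ'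
  have hψd : ∀ n x, HasFDerivAt (ψ n)
      (deriv Real.smoothTransition (1 + n * (‖x‖ ^ 2 - lam ^ 2)) •
        ((n:ℝ) • (2 • (innerSL ℝ x)))) x := by
    intro n x
    have h1 := (((hasStrictFDerivAt_norm_sq x).hasFDerivAt.sub_const (lam ^ 2)).const_mul
      (n:ℝ)).const_add 1
    exact (sT_hasDeriv _).comp_hasFDerivAt x h1
  have hψf : ∀ n x, fderiv ℝ (ψ n) x v = ψ' n x := by
    intro n x
    rw [(hψd n x).fderiv]
    simp [hψ']
  have hψ'c : ∀ n, Continuous (ψ' n) := by intro n; rw [hψ']; fun_prop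
  have hψ'b : ∀ n, ∃ C, ∀ x, ‖ψ' n x‖ ≤ C := by
    intro n
    have hcs : HasCompactSupport (ψ' n) := by
      apply HasCompactSupport.intro (isCompact_closedBall (0 : E3) lam)
      intro x hx
      have hx : lam < ‖x‖ := by simpa using hx
      simp only [hψ']
      rw [sT_deriv_one, zero_mul]
      have : 0 ≤ (n:ℝ) * (‖x‖ ^ 2 - lam ^ 2) := mul_nonneg (by positivity) (by nlinarith)
      linarith
    exact hcs.exists_bound_of_continuous (hψ'c n)
  have hz : ∀ n : ℕ, (n:ℝ) * (b ^ 2 - lam ^ 2) ≤ -1 → ∀ x : E3, ‖x‖ ≤ b →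
      1 + (n:ℝ) * (‖x‖ ^ 2 - lam ^ 2) ≤ 0 := by
    intro n hn x hx
    have : (n:ℝ) * (‖x‖ ^ 2 - lam ^ 2) ≤ n * (b ^ 2 - lam ^ 2) := by gcongr
    linarith
  have hev := ev_n hb0.le hbl
  -- integrability of (bounded, vanishing inside) * (integrable outside)
  have key : ∀ (u g : E3 → ℝ) (C : ℝ), Continuous u → (∀ x, ‖u x‖ ≤ C) →
      (∀ x, ‖x‖ ≤ b → u x = 0) → IntegrableOn g {x : E3 | 1 < ‖x‖} →
      Integrable (fun x => u x * g x) := by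
    intro u g C hu hC hu0 hg
    have h1 := (hg.integrable_indicator hmeas).bdd_mul (f := u) hu.aestronglyMeasurable
      (Eventually.of_forall hC)
    refine h1.congr (Eventually.of_forall fun x => ?_)
    by_cases hx : 1 < ‖x‖
    · simp [indicator, hx]
    · simp [hu0 x (by linarith)]
  have hibp : ∀ n : ℕ, (n:ℝ) * (b ^ 2 - lam ^ 2) ≤ -1 →
      Integrable (fun x => ψ' n x * f x) ∧
      ∫ x, ψ n x * fderiv ℝ f x v = - ∫ x, ψ' n x * f x := by
    intro n hn
    obtain ⟨C, hC⟩ := hψ'b n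
    have hz0 : ∀ x, ‖x‖ ≤ b → ψ n x = 0 := fun x hx =>
      Real.smoothTransition.zero_of_nonpos (hz n hn x hx)
    have hz1 : ∀ x, ‖x‖ ≤ b → ψ' n x = 0 := fun x hx => by
      simp only [hψ']; rw [sT_deriv_neg (hz n hn x hx), zero_mul]
    have i1 := key (ψ' n) f C (hψ'c n) hC hz1 hi
    have i2 := key (ψ n) _ 1 (hψc n) (hψb n) hz0 hi'
    have i3 := key (ψ n) f 1 (hψc n) (hψb n) hz0 hi
    refine ⟨i1, ?_⟩
    have := integral_mul_fderiv_eq_neg_fderiv_mul_of_integrable (μ := (volume : Measure E3))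
      (f := ψ n) (g := f) (v := v) (by simpa only [hψf] using i1) i2 i3
      (fun x _ => (hψd n x).differentiableAt) (fun x hx => ?_)
    · simpa only [hψf] using this
    · have hxb : b ≤ ‖x‖ := by
        have hcl : IsClosed {x : E3 | b ≤ ‖x‖} := isClosed_le continuous_const continuous_norm
        refine closure_minimal ?_ hcl hx
        intro z hz
        by_contra hc
        exact hz (hz0 z (le_of_lt (by simpa using hc)))
      exact (hf.contDiffAt (hopen.mem_nhds (show 1 < ‖x‖ by linarith))).differentiableAt (by norm_num)
  -- left limit
  have hL : Tendsto (fun n => ∫ x, ψ n x * fderiv ℝ f x v) atTop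
      (𝓝 (∫ x in {x : E3 | lam ≤ ‖x‖}, fderiv ℝ f x v)) := by
    rw [← integral_indicator hmeasl]
    have hcongr : (fun n => ∫ x, ψ n x * ({x : E3 | 1 < ‖x‖}.indicator (fun x => fderiv ℝ f x v)) x)
        =ᶠ[atTop] (fun n => ∫ x, ψ n x * fderiv ℝ f x v) := by
      filter_upwards [hev] with n hn
      congr 1
      ext x
      by_cases hx : 1 < ‖x‖
      · simp [indicator, hx]
      · have : ψ n x = 0 := Real.smoothTransition.zero_of_nonpos (hz n hn x (by linarith))
        simp [this]
    refine Tendsto.congr' hcongr ?_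
    have hI := hi'.integrable_indicator hmeas
    refine tendsto_integral_of_dominated_convergence
      (fun x => ‖({x : E3 | 1 < ‖x‖}.indicator (fun x => fderiv ℝ f x v)) x‖) ?_ hI.norm ?_ ?_
    · intro n
      exact (hψc n).aestronglyMeasurable.mul hI.aestronglyMeasurable
    · intro n
      refine Eventually.of_forall fun x => ?_
      rw [norm_mul]
      exact mul_le_of_le_one_left (norm_nonneg _) (hψb n x)
    · refine Eventually.of_forall fun x => ?_
      by_cases hx : lam ≤ ‖x‖
      · have h1 : 1 < ‖x‖ := by linarith
        have : ∀ n, ψ n x = 1 := by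
          intro n
          apply Real.smoothTransition.one_of_one_le
          have : 0 ≤ (n:ℝ) * (‖x‖ ^ 2 - lam ^ 2) := mul_nonneg (by positivity) (by nlinarith)
          linarith
        simp [this, indicator, hx, h1]
      · have : (fun _ : ℕ => (0:ℝ)) =ᶠ[atTop] (fun n => ψ n x *
            ({x : E3 | 1 < ‖x‖}.indicator (fun x => fderiv ℝ f x v)) x) := by
          filter_upwards [ev_n (norm_nonneg x) (not_le.1 hx)] with n hn
          have : ψ n x = 0 := Real.smoothTransition.zero_of_nonpos (by linarith)
          simp [this]
        refine Tendsto.congr' this ?_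
        simp [indicator, hx]
  -- right limit
  set h : sphere (0 : E3) 1 → ℝ → ℝ := fun y r =>
    r ^ 2 * (inner ℝ (y : E3) v * f (r • (y : E3))) with hh
  have hcont : ContinuousOn (fun p : sphere (0 : E3) 1 × ℝ => h p.1 p.2) (univ ×ˢ Icc b lam) := by
    simp only [hh]
    refine ContinuousOn.mul (by fun_prop) (ContinuousOn.mul (by fun_prop) ?_)
    refine hf.continuousOn.comp (t := {x : E3 | 1 < ‖x‖}) (by fun_prop) ?_
    rintro ⟨y, r⟩ ⟨_, hr⟩
    have hr0 : 0 < r := hb0.trans_le hr.1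
    have hy : ‖(y : E3)‖ = 1 := by simp
    show 1 < ‖r • (y : E3)‖
    rw [norm_smul, hy, mul_one, Real.norm_of_nonneg hr0.le]
    exact hb1.trans_le hr.1
  obtain ⟨M, hM⟩ := (isCompact_univ.prod isCompact_Icc).exists_bound_of_continuousOn hcont
  have hR : Tendsto (fun n => ∫ x, ψ' n x * f x) atTop
      (𝓝 (∫ y : sphere (0 : E3) 1, h y lam ∂(volume : Measure E3).toSphere)) := by
    have hpol : ∀ n : ℕ, ∀ y : sphere (0 : E3) 1,
        ∫ r in Ioi (0:ℝ), r ^ 2 * (ψ' n (r • (y : E3)) * f (r • (y : E3)))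
        = ∫ r in Ioi (0:ℝ), pk lam n r * h y r := by
      intro n y
      refine setIntegral_congr_fun measurableSet_Ioi fun r hr => ?_
      have hr : 0 < r := hr
      have hy : ‖(y : E3)‖ = 1 := by simp
      simp only [hψ', hh, pk, norm_smul, hy, mul_one, Real.norm_of_nonneg hr.le,
        real_inner_smul_left]
      ring
    have hcongr : (fun n : ℕ => ∫ y : sphere (0 : E3) 1, (∫ r in Ioi (0:ℝ), pk lam n r * h y r)
          ∂(volume : Measure E3).toSphere)
        =ᶠ[atTop] (fun n => ∫ x, ψ' n x * f x) := by
      filter_upwards [hev] with n hn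
      rw [(polar_aux _ (hibp n hn).1).2]
      simp only [hpol]
    refine Tendsto.congr' hcongr ?_
    refine tendsto_integral_filter_of_dominated_convergence (fun _ => M) ?_ ?_
      (integrable_const _) ?_
    · filter_upwards [hev] with n hn
      have := (polar_aux _ (hibp n hn).1).1.aestronglyMeasurable
      simpa only [hpol] using this
    · filter_upwards [hev] with n hn
      refine Eventually.of_forall fun y => ?_
      rw [pk_Ioi hb0 hbl hn, Real.norm_eq_abs]
      refine pk_bound hb0 hbl hn _ fun r hr _ => ?_
      exact hM (y, r) ⟨mem_univ _, hr.1.le, hr.2⟩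
    · refine Eventually.of_forall fun y => ?_
      refine pk_tendsto hb0 hbl (h y) ?_
      exact hcont.comp (f := fun r : ℝ => (y, r)) (by fun_prop) fun r hr => ⟨mem_univ _, hr⟩
  refine tendsto_nhds_unique hL ?_
  refine Tendsto.congr' ?_ hR.neg
  filter_upwards [hev] with n hn
  exact (hibp n hn).2.symm

lemma open1 : IsOpen {x : E3 | 1 < ‖x‖} := isOpen_lt continuous_const continuous_norm

lemma pd_contDiffOn (σ : E3 → Matrix (Fin 3) (Fin 3) ℝ)
    (hσ : ∀ i j, ContDiffOn ℝ 2 (fun y => σ y i j) {x : E3 | 1 ≤ ‖x‖}) (k l m : Fin 3) :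
    ContDiffOn ℝ 1 (pd σ k l m) {x : E3 | 1 < ‖x‖} := by
  have h := (hσ l m).mono (t := {x : E3 | 1 < ‖x‖})
    (fun x (hx : 1 < ‖x‖) => show 1 ≤ ‖x‖ from hx.le)
  have h2 := h.fderiv_of_isOpen open1 (m := 1) (by norm_num)
  exact h2.clm_apply contDiffOn_const

/-- the atom `|x|⁻³ xⱼ ∂ₖ σₗₘ` -/
noncomputable def gA (σ : E3 → Matrix (Fin 3) (Fin 3) ℝ) (j k l m : Fin 3) (x : E3) : ℝ :=
  x j * (‖x‖ ^ 3)⁻¹ * pd σ k l m x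

/-- its `i`-th derivative -/
noncomputable def tA (σ : E3 → Matrix (Fin 3) (Fin 3) ℝ) (i j k l m : Fin 3) (x : E3) : ℝ :=
  ((if i = j then 1 else 0) * (‖x‖ ^ 3)⁻¹ - 3 * (x i * x j) * ((‖x‖ ^ 2)⁻¹ * (‖x‖ ^ 3)⁻¹))
    * pd σ k l m x + x j * (‖x‖ ^ 3)⁻¹ * pd2 σ i k l m x

lemma hasFDerivAt_inv_cube (x : E3) (hx : 0 < ‖x‖) :
    HasFDerivAt (fun x : E3 => (‖x‖ ^ 3)⁻¹)
      ((-((‖x‖ ^ 3) ^ 2)⁻¹) • ((3 * ‖x‖) • innerSL ℝ x)) x := by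
  have h1 : HasFDerivAt (fun x : E3 => ‖x‖ ^ 3) ((3 * ‖x‖) • innerSL ℝ x) x := by
    have := hasFDerivAt_norm_rpow x (p := 3) (by norm_num)
    norm_num at this
    exact this
  exact (hasDerivAt_inv (by positivity)).comp_hasFDerivAt x h1

lemma coord_le (x : E3) (j : Fin 3) : |x j| ≤ ‖x‖ := by
  simpa using PiLp.norm_apply_le x j

lemma contDiffOn_gA (σ : E3 → Matrix (Fin 3) (Fin 3) ℝ)
    (hσ : ∀ i j, ContDiffOn ℝ 2 (fun y => σ y i j) {x : E3 | 1 ≤ ‖x‖}) (j k l m : Fin 3) :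
    ContDiffOn ℝ 1 (gA σ j k l m) {x : E3 | 1 < ‖x‖} := by
  unfold gA
  refine ContDiffOn.mul (ContDiffOn.mul (by fun_prop) ?_) (pd_contDiffOn σ hσ k l m)
  intro x hx
  have hx : 1 < ‖x‖ := hx
  have hx0 : x ≠ 0 := norm_pos_iff.1 (by linarith)
  refine (ContDiffAt.inv ((contDiffAt_norm ℝ hx0).pow 3) ?_).contDiffWithinAt
  have : 0 < ‖x‖ := by linarith
  positivity

lemma fderiv_gA (σ : E3 → Matrix (Fin 3) (Fin 3) ℝ)
    (hσ : ∀ i j, ContDiffOn ℝ 2 (fun y => σ y i j) {x : E3 | 1 ≤ ‖x‖}) (i j k l m : Fin 3)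
    (x : E3) (hx : 1 < ‖x‖) :
    fderiv ℝ (gA σ j k l m) x (EuclideanSpace.single i 1) = tA σ i j k l m x := by
  have hx0 : 0 < ‖x‖ := by linarith
  have h1 : HasFDerivAt (fun x : E3 => x j) (EuclideanSpace.proj j : E3 →L[ℝ] ℝ) x :=
    (EuclideanSpace.proj j : E3 →L[ℝ] ℝ).hasFDerivAt
  have h2 := hasFDerivAt_inv_cube x hx0
  have h3 : HasFDerivAt (pd σ k l m) (fderiv ℝ (pd σ k l m) x) x :=
    (((pd_contDiffOn σ hσ k l m).contDiffAt (open1.mem_nhds hx)).differentiableAt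
      (by norm_num)).hasFDerivAt
  have h4 := (h1.mul h2).mul h3
  have h5 : HasFDerivAt (gA σ j k l m) _ x := h4
  rw [h5.fderiv]
  have e : fderiv ℝ (pd σ k l m) x (EuclideanSpace.single i 1) = pd2 σ i k l m x := rfl
  have hs : (EuclideanSpace.single i (1:ℝ) : E3) j = if i = j then 1 else 0 := by
    simp [eq_comm]
  have hp : (EuclideanSpace.proj j : E3 →L[ℝ] ℝ) (EuclideanSpace.single i (1:ℝ))
      = if i = j then 1 else 0 := hs
  have hm : ((fun x : E3 => x j) * fun x : E3 => (‖x‖ ^ 3)⁻¹) x = x j * (‖x‖ ^ 3)⁻¹ := rfl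
  have hin : inner ℝ x (EuclideanSpace.single i (1:ℝ)) = x i := by
    rw [EuclideanSpace.inner_single_right]; simp
  simp only [add_apply, smul_apply, smul_eq_mul, e,
    innerSL_apply_apply, hin, hp, hm, tA]
  field_simp
  ring

lemma int5 : IntegrableOn (fun x : E3 => (‖x‖ ^ 5)⁻¹) {x : E3 | 1 < ‖x‖} := by
  have h := (integrable_one_add_norm (E := E3) (μ := volume) (r := 5) (by simp; norm_num)).const_mul 32
  refine Integrable.mono' h.integrableOn ?_ ?_
  · refine (Measurable.aestronglyMeasurable ?_)
    fun_prop
  · refine (ae_restrict_mem open1.measurableSet).mono fun x hx => ?_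
    have hx : 1 < ‖x‖ := hx
    have hx0 : 0 < ‖x‖ := by linarith
    rw [Real.norm_of_nonneg (by positivity), Real.rpow_neg (by positivity)]
    have : (1 + ‖x‖) ^ (5:ℝ) = (1 + ‖x‖) ^ 5 := by exact_mod_cast Real.rpow_natCast _ 5
    rw [this]
    have h2 : (1 + ‖x‖) ^ 5 ≤ (2 * ‖x‖) ^ 5 := by gcongr; linarith
    rw [← div_eq_mul_inv, inv_eq_one_div, div_le_div_iff₀ (by positivity) (by positivity)]
    nlinarith

lemma atom (σ : E3 → Matrix (Fin 3) (Fin 3) ℝ)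
    (hσ : ∀ i j, ContDiffOn ℝ 2 (fun y => σ y i j) {x : E3 | 1 ≤ ‖x‖})
    (c : ℝ) (hc : 0 < c)
    (hσ1 : ∀ x : E3, 1 ≤ ‖x‖ → ∀ k i j, |pd σ k i j x| ≤ c * (‖x‖ ^ 3)⁻¹)
    (hσ2 : ∀ x : E3, 1 ≤ ‖x‖ → ∀ k l i j, |pd2 σ k l i j x| ≤ c * (‖x‖ ^ 4)⁻¹)
    (lam : ℝ) (hlam : 1 < lam) (i j k l m : Fin 3) :
    IntegrableOn (tA σ i j k l m) {x : E3 | lam ≤ ‖x‖} ∧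
    ∫ x in {x : E3 | lam ≤ ‖x‖}, tA σ i j k l m x =
      - ∫ y : sphere (0 : E3) 1, (y : E3) i * (y : E3) j * pd σ k l m (lam • (y : E3))
          ∂(volume : Measure E3).toSphere := by
  have hcd := contDiffOn_gA σ hσ j k l m
  have hsub : {x : E3 | lam ≤ ‖x‖} ⊆ {x : E3 | 1 < ‖x‖} := fun x hx => lt_of_lt_of_le hlam hx
  have hml : MeasurableSet {x : E3 | lam ≤ ‖x‖} :=
    (isClosed_le continuous_const continuous_norm).measurableSet
  have i1 : IntegrableOn (gA σ j k l m) {x : E3 | 1 < ‖x‖} := by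
    refine Integrable.mono' (int5.const_mul c)
      (hcd.continuousOn.aestronglyMeasurable open1.measurableSet) ?_
    refine (ae_restrict_mem open1.measurableSet).mono fun x hx => ?_
    have hx : 1 < ‖x‖ := hx
    have hx0 : 0 < ‖x‖ := by linarith
    rw [gA, norm_mul, norm_mul, norm_inv, Real.norm_eq_abs, Real.norm_eq_abs, Real.norm_eq_abs,
      abs_of_pos (pow_pos hx0 3)]
    calc |x j| * (‖x‖ ^ 3)⁻¹ * |pd σ k l m x|
        ≤ ‖x‖ * (‖x‖ ^ 3)⁻¹ * (c * (‖x‖ ^ 3)⁻¹) := by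
          gcongr
          · exact coord_le x j
          · exact hσ1 x hx.le k l m
      _ = c * (‖x‖ ^ 5)⁻¹ := by field_simp
  have i2 : IntegrableOn (fun x => fderiv ℝ (gA σ j k l m) x (EuclideanSpace.single i 1))
      {x : E3 | 1 < ‖x‖} := by
    refine Integrable.mono' (int5.const_mul (5 * c)) (ContinuousOn.aestronglyMeasurable
      ((hcd.continuousOn_fderiv_of_isOpen open1 (by norm_num)).clm_apply continuousOn_const)
      open1.measurableSet) ?_
    refine (ae_restrict_mem open1.measurableSet).mono fun x hx => ?_
    have hx : 1 < ‖x‖ := hx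
    have hx0 : 0 < ‖x‖ := by linarith
    have hr : (‖x‖ ^ 6)⁻¹ ≤ (‖x‖ ^ 5)⁻¹ := by
      gcongr
      · exact hx.le
      · norm_num
    rw [fderiv_gA σ hσ i j k l m x hx, tA, Real.norm_eq_abs]
    have b1 : |(if i = j then 1 else 0) * (‖x‖ ^ 3)⁻¹
        - 3 * (x i * x j) * ((‖x‖ ^ 2)⁻¹ * (‖x‖ ^ 3)⁻¹)| ≤ 4 * (‖x‖ ^ 3)⁻¹ := by
      have c1 : |(if i = j then (1:ℝ) else 0) * (‖x‖ ^ 3)⁻¹| ≤ (‖x‖ ^ 3)⁻¹ := by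
        split_ifs
        · rw [one_mul, abs_of_pos (by positivity)]
        · rw [zero_mul, abs_zero]; positivity
      have c2 : |3 * (x i * x j) * ((‖x‖ ^ 2)⁻¹ * (‖x‖ ^ 3)⁻¹)| ≤ 3 * (‖x‖ ^ 3)⁻¹ := by
        rw [abs_mul, abs_mul, abs_mul, abs_of_pos (show (0:ℝ) < 3 by norm_num),
          abs_of_pos (show 0 < (‖x‖ ^ 2)⁻¹ * (‖x‖ ^ 3)⁻¹ by positivity)]
        calc 3 * (|x i| * |x j|) * ((‖x‖ ^ 2)⁻¹ * (‖x‖ ^ 3)⁻¹)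
            ≤ 3 * (‖x‖ * ‖x‖) * ((‖x‖ ^ 2)⁻¹ * (‖x‖ ^ 3)⁻¹) := by
              gcongr
              · exact coord_le x i
              · exact coord_le x j
          _ = 3 * (‖x‖ ^ 3)⁻¹ := by field_simp
      have := abs_sub ((if i = j then (1:ℝ) else 0) * (‖x‖ ^ 3)⁻¹)
        (3 * (x i * x j) * ((‖x‖ ^ 2)⁻¹ * (‖x‖ ^ 3)⁻¹))
      linarith
    have b2 : |x j * (‖x‖ ^ 3)⁻¹ * pd2 σ i k l m x| ≤ c * (‖x‖ ^ 6)⁻¹ := by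
      rw [abs_mul, abs_mul, abs_inv, abs_of_pos (pow_pos hx0 3)]
      calc |x j| * (‖x‖ ^ 3)⁻¹ * |pd2 σ i k l m x|
          ≤ ‖x‖ * (‖x‖ ^ 3)⁻¹ * (c * (‖x‖ ^ 4)⁻¹) := by
            gcongr
            · exact coord_le x j
            · exact hσ2 x hx.le i k l m
        _ = c * (‖x‖ ^ 6)⁻¹ := by field_simp
    have b3 := hσ1 x hx.le k l m
    calc _ ≤ _ := abs_add_le _ _
      _ ≤ 4 * (‖x‖ ^ 3)⁻¹ * (c * (‖x‖ ^ 3)⁻¹) + c * (‖x‖ ^ 6)⁻¹ := by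
          rw [abs_mul]
          gcongr
      _ = 5 * c * (‖x‖ ^ 6)⁻¹ := by field_simp; ring
      _ ≤ _ := by gcongr
  constructor
  · refine (i2.mono_set hsub).congr_fun (fun x hx => ?_) hml
    exact fderiv_gA σ hσ i j k l m x (hsub hx)
  · have := ext_div _ _ hcd i1 i2 lam hlam
    rw [← setIntegral_congr_fun hml fun x hx => fderiv_gA σ hσ i j k l m x (hsub hx), this]
    congr 1
    refine integral_congr_ae (Filter.Eventually.of_forall fun y => ?_)
    have hy : ‖(y : E3)‖ = 1 := by simp
    have hl : 0 < lam := by linarith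
    have hin : inner ℝ (y : E3) (EuclideanSpace.single i (1:ℝ)) = (y : E3) i := by
      rw [EuclideanSpace.inner_single_right]; simp
    simp only [hin, gA, norm_smul, hy, mul_one, Real.norm_of_nonneg hl.le, PiLp.smul_apply,
      smul_eq_mul]
    field_simp

lemma sphere_cont (σ : E3 → Matrix (Fin 3) (Fin 3) ℝ)
    (hσ : ∀ i j, ContDiffOn ℝ 2 (fun y => σ y i j) {x : E3 | 1 ≤ ‖x‖})
    (lam : ℝ) (hlam : 1 < lam) (i j k l m : Fin 3) :
    Integrable (fun y : sphere (0 : E3) 1 =>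
      (y : E3) i * (y : E3) j * pd σ k l m (lam • (y : E3))) (volume : Measure E3).toSphere := by
  have hc : Continuous (fun y : sphere (0 : E3) 1 =>
      (y : E3) i * (y : E3) j * pd σ k l m (lam • (y : E3))) := by
    refine Continuous.mul (by fun_prop) ?_
    refine (pd_contDiffOn σ hσ k l m).continuousOn.comp_continuous (by fun_prop) fun y => ?_
    have hy : ‖(y : E3)‖ = 1 := by simp
    show 1 < ‖lam • (y : E3)‖
    rw [norm_smul, hy, mul_one, Real.norm_of_nonneg (by linarith)]
    exact hlam
  exact hc.integrable_of_hasCompactSupport (HasCompactSupport.of_compactSpace _)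

lemma pointwise_id (σ : E3 → Matrix (Fin 3) (Fin 3) ℝ) (a x : E3) (hx : 0 < ‖x‖) :
    (‖x‖ ^ 3)⁻¹ *
            ((∑ i : Fin 3, ∑ j : Fin 3, ∑ k : Fin 3,
                (x j * a k + a j * x k) * pd2 σ i j i k x) -
              (∑ j : Fin 3, ∑ k : Fin 3, x j * a k * ∑ i : Fin 3, pd2 σ i i j k x) -
              (∑ j : Fin 3, ∑ k : Fin 3, x j * a k * ∑ i : Fin 3, pd2 σ j k i i x) +
              (∑ k : Fin 3, a k * ∑ i : Fin 3, pd σ k i i x) -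
              3 * (‖x‖ ^ 2)⁻¹ *
                ∑ k : Fin 3, ∑ i : Fin 3, ∑ j : Fin 3, a k * x i * x j * pd σ k i j x)
    = ∑ k : Fin 3, ∑ i : Fin 3, ∑ j : Fin 3, a k * (tA σ i j k i j x + tA σ i j j i k x
        - tA σ i j i j k x - tA σ j j k i i x) := by
  have hn : ‖x‖ ^ 2 = x 0 ^ 2 + x 1 ^ 2 + x 2 ^ 2 := by
    rw [EuclideanSpace.norm_sq_eq]; simp [Fin.sum_univ_three]
  have h0 : (‖x‖ ^ 2)⁻¹ * (x 0 ^ 2 + x 1 ^ 2 + x 2 ^ 2) = 1 := by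
    rw [← hn]; field_simp
  simp only [tA]
  generalize (‖x‖ ^ 3)⁻¹ = R at *
  generalize (‖x‖ ^ 2)⁻¹ = Q at *
  have e01 : ((0 : Fin 3) = 1) = False := by simp
  have e02 : ((0 : Fin 3) = 2) = False := by simp
  have e10 : ((1 : Fin 3) = 0) = False := by simp
  have e12 : ((1 : Fin 3) = 2) = False := by simp
  have e20 : ((2 : Fin 3) = 0) = False := by simp
  have e21 : ((2 : Fin 3) = 1) = False := by simp
  simp only [Fin.sum_univ_three, e01, e02, e10, e12, e20, e21, if_true, if_false]
  linear_combination (-3 * R * (a 0 * (pd σ 0 0 0 x + pd σ 0 1 1 x + pd σ 0 2 2 x)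
    + a 1 * (pd σ 1 0 0 x + pd σ 1 1 1 x + pd σ 1 2 2 x)
    + a 2 * (pd σ 2 0 0 x + pd σ 2 1 1 x + pd σ 2 2 2 x))) * h0

lemma integral_four {X : Type*} [MeasurableSpace X] (μ : Measure X) (f g h k : X → ℝ)
    (hf : Integrable f μ) (hg : Integrable g μ) (hh : Integrable h μ) (hk : Integrable k μ) :
    ∫ x, (f x + g x - h x - k x) ∂μ
      = ∫ x, f x ∂μ + ∫ x, g x ∂μ - ∫ x, h x ∂μ - ∫ x, k x ∂μ := by
  have e1 := integral_sub ((hf.add hg).sub hh) hk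
  have e2 := integral_sub (hf.add hg) hh
  have e3 := integral_add hf hg
  simp only [Pi.add_apply, Pi.sub_apply] at e1 e2 e3
  rw [e1, e2, e3]

theorem stmt12 (σ : E3 → Matrix (Fin 3) (Fin 3) ℝ)
    (hsym : ∀ x i j, σ x i j = σ x j i)
    (hσ : ∀ i j, ContDiffOn ℝ 2 (fun y => σ y i j) {x : E3 | 1 ≤ ‖x‖})
    (c : ℝ) (hc : 0 < c)
    (hσ0 : ∀ x : E3, 1 ≤ ‖x‖ → ∀ i j, |σ x i j| ≤ c * (‖x‖ ^ 2)⁻¹)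
    (hσ1 : ∀ x : E3, 1 ≤ ‖x‖ → ∀ k i j, |pd σ k i j x| ≤ c * (‖x‖ ^ 3)⁻¹)
    (hσ2 : ∀ x : E3, 1 ≤ ‖x‖ → ∀ k l i j, |pd2 σ k l i j x| ≤ c * (‖x‖ ^ 4)⁻¹)
    (lam : ℝ) (hlam : 1 < lam) (a : E3) :
    MeasureTheory.IntegrableOn
        (fun x : E3 =>
          (‖x‖ ^ 3)⁻¹ *
            ((∑ i : Fin 3, ∑ j : Fin 3, ∑ k : Fin 3,
                (x j * a k + a j * x k) * pd2 σ i j i k x) -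
              (∑ j : Fin 3, ∑ k : Fin 3, x j * a k * ∑ i : Fin 3, pd2 σ i i j k x) -
              (∑ j : Fin 3, ∑ k : Fin 3, x j * a k * ∑ i : Fin 3, pd2 σ j k i i x) +
              (∑ k : Fin 3, a k * ∑ i : Fin 3, pd σ k i i x) -
              3 * (‖x‖ ^ 2)⁻¹ *
                ∑ k : Fin 3, ∑ i : Fin 3, ∑ j : Fin 3, a k * x i * x j * pd σ k i j x))
        {x : E3 | lam ≤ ‖x‖} volume ∧
      ((∫ x in {x : E3 | lam ≤ ‖x‖},
          (‖x‖ ^ 3)⁻¹ *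
            ((∑ i : Fin 3, ∑ j : Fin 3, ∑ k : Fin 3,
                (x j * a k + a j * x k) * pd2 σ i j i k x) -
              (∑ j : Fin 3, ∑ k : Fin 3, x j * a k * ∑ i : Fin 3, pd2 σ i i j k x) -
              (∑ j : Fin 3, ∑ k : Fin 3, x j * a k * ∑ i : Fin 3, pd2 σ j k i i x) +
              (∑ k : Fin 3, a k * ∑ i : Fin 3, pd σ k i i x) -
              3 * (‖x‖ ^ 2)⁻¹ *
                ∑ k : Fin 3, ∑ i : Fin 3, ∑ j : Fin 3, a k * x i * x j * pd σ k i j x)) =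
        (lam ^ 2)⁻¹ *
          sphereIntegral lam 0
            (fun x =>
              (∑ k : Fin 3, a k * ∑ i : Fin 3, pd σ k i i x) -
                ∑ k : Fin 3, ∑ i : Fin 3, ∑ j : Fin 3,
                  a k * (lam⁻¹ * x i) * (lam⁻¹ * x j) * pd σ k i j x)) := by
  have hml : MeasurableSet {x : E3 | lam ≤ ‖x‖} :=
    (isClosed_le continuous_const continuous_norm).measurableSet
  have hat := atom σ hσ c hc hσ1 hσ2 lam hlam
  have hsp := sphere_cont σ hσ lam hlam
  have hpt : ∀ x ∈ {x : E3 | lam ≤ ‖x‖}, _ := fun x (hx : lam ≤ ‖x‖) =>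
    (pointwise_id σ a x (by linarith)).symm
  have hterm : ∀ k i j : Fin 3, IntegrableOn (fun x => a k * (tA σ i j k i j x + tA σ i j j i k x
        - tA σ i j i j k x - tA σ j j k i i x)) {x : E3 | lam ≤ ‖x‖} := fun k i j =>
    ((((hat i j k i j).1.add (hat i j j i k).1).sub (hat i j i j k).1).sub
      (hat j j k i i).1).const_mul (a k)
  have hsum : IntegrableOn (fun x => ∑ k : Fin 3, ∑ i : Fin 3, ∑ j : Fin 3,
      a k * (tA σ i j k i j x + tA σ i j j i k x
        - tA σ i j i j k x - tA σ j j k i i x)) {x : E3 | lam ≤ ‖x‖} :=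
    integrable_finsetSum _ fun k _ => integrable_finsetSum _ fun i _ =>
      integrable_finsetSum _ fun j _ => hterm k i j
  refine ⟨hsum.congr_fun hpt hml, ?_⟩
  rw [← setIntegral_congr_fun hml hpt]
  -- abbreviations on the sphere
  set S : Fin 3 → Fin 3 → Fin 3 → Fin 3 → Fin 3 → sphere (0 : E3) 1 → ℝ :=
    fun i j k l m y => (y : E3) i * (y : E3) j * pd σ k l m (lam • (y : E3)) with hS
  have hval : ∀ k i j : Fin 3, ∫ x in {x : E3 | lam ≤ ‖x‖}, a k * (tA σ i j k i j x
        + tA σ i j j i k x - tA σ i j i j k x - tA σ j j k i i x)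
      = ∫ y, a k * (S j j k i i y + S i j i j k y - S i j j i k y - S i j k i j y)
          ∂(volume : Measure E3).toSphere := by
    intro k i j
    rw [integral_const_mul, integral_const_mul]
    congr 1
    rw [integral_four _ _ _ _ _ (hat i j k i j).1 (hat i j j i k).1 (hat i j i j k).1
        (hat j j k i i).1,
      integral_four _ _ _ _ _ (hsp j j k i i) (hsp i j i j k) (hsp i j j i k) (hsp i j k i j),
      (hat i j k i j).2, (hat i j j i k).2, (hat i j i j k).2, (hat j j k i i).2]
    ring
  have hterm' : ∀ k i j : Fin 3, Integrable (fun y => a k * (S j j k i i y + S i j i j k y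
      - S i j j i k y - S i j k i j y)) (volume : Measure E3).toSphere := fun k i j =>
    ((((hsp j j k i i).add (hsp i j i j k)).sub (hsp i j j i k)).sub (hsp i j k i j)).const_mul (a k)
  have hsw : ∫ x in {x : E3 | lam ≤ ‖x‖}, ∑ k : Fin 3, ∑ i : Fin 3, ∑ j : Fin 3,
      a k * (tA σ i j k i j x + tA σ i j j i k x - tA σ i j i j k x - tA σ j j k i i x)
      = ∫ y, ∑ k : Fin 3, ∑ i : Fin 3, ∑ j : Fin 3,
        a k * (S j j k i i y + S i j i j k y - S i j j i k y - S i j k i j y)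
          ∂(volume : Measure E3).toSphere := by
    rw [integral_finsetSum _ fun k _ => integrable_finsetSum _ fun i _ =>
      integrable_finsetSum _ fun j _ => hterm k i j,
      integral_finsetSum _ fun k _ => integrable_finsetSum _ fun i _ =>
      integrable_finsetSum _ fun j _ => hterm' k i j]
    refine Finset.sum_congr rfl fun k _ => ?_
    rw [integral_finsetSum _ fun i _ => integrable_finsetSum _ fun j _ => hterm k i j,
      integral_finsetSum _ fun i _ => integrable_finsetSum _ fun j _ => hterm' k i j]
    refine Finset.sum_congr rfl fun i _ => ?_
    rw [integral_finsetSum _ fun j _ => hterm k i j, integral_finsetSum _ fun j _ => hterm' k i j]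
    exact Finset.sum_congr rfl fun j _ => hval k i j
  rw [hsw, sphereIntegral, ← mul_assoc, inv_mul_cancel₀ (by positivity), one_mul]
  refine integral_congr_ae (Filter.Eventually.of_forall fun y => ?_)
  have hl : lam ≠ 0 := by linarith
  have hy : (y : E3) 0 ^ 2 + (y : E3) 1 ^ 2 + (y : E3) 2 ^ 2 = 1 := by
    have h1 : ‖(y : E3)‖ = 1 := by simp
    have h2 := EuclideanSpace.norm_sq_eq (y : E3)
    rw [h1] at h2
    simp [Fin.sum_univ_three] at h2
    linarith
  simp only [zero_add, PiLp.smul_apply, smul_eq_mul, inv_mul_cancel_left₀ hl, hS]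
  simp only [Fin.sum_univ_three]
  generalize lam • (y : E3) = z at *
  linear_combination (a 0 * (pd σ 0 0 0 z + pd σ 0 1 1 z + pd σ 0 2 2 z)
    + a 1 * (pd σ 1 0 0 z + pd σ 1 1 1 z + pd σ 1 2 2 z)
    + a 2 * (pd σ 2 0 0 z + pd σ 2 1 1 z + pd σ 2 2 2 z)) * hy
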